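/- arXiv:1709.10505 — 2 statements merged into one kernel-verified Lean document; each statement's English description precedes it below -/
import Mathlib

section
/- (Theorem 5: asymptotic normality of the Bregman divergence estimator under misspecification.) Let F, G ∈ ℝ^{M₀}. Let (P̂_n) and (Q̂_n) be sequences of random vectors in ℝ^{M₀} such that √n·((P̂_n − F), (Q̂_n − G)) converges in distribution to a centered Gaussian law μ on ℝ^{2M₀}. Define the gradient vectors K, N ∈ ℝ^{M₀} by K_i := ∂D/∂p_i(F,G) = φ'(F_i) − φ'(G_i) and N_i := ∂D/∂q_i(F,G) = −(F_i − G_i) φ''(G_i). Then √n·(D(P̂_n, Q̂_n) − D(F, G)) converges in distribution to the pushforward of μ under the linear map (x, y) ↦ Kᵀx + Nᵀy, which is a centered normal law with variance Λ_φ² := ∫ (Kᵀx + Nᵀy)² dμ(x,y). -/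
open MeasureTheory ProbabilityTheory Filter Topology

/-- The Bregman divergence on `ℝ^{M₀}`:
`D(p,q) = Σ_i [φ(p_i) − φ(q_i) − (p_i − q_i) φ'(q_i)]`. -/
noncomputable def bregmanVec (φ : ℝ → ℝ) {M₀ : ℕ} (p q : Fin M₀ → ℝ) : ℝ :=
  ∑ i, (φ (p i) - φ (q i) - (p i - q i) * deriv φ (q i))

lemma aux_gauss {ι : Type*} [Fintype ι] (c : ι → ℝ) :
    Measure.map (fun z : ι → ℝ => ∑ i, c i * z i) (Measure.pi fun _ : ι => gaussianReal 0 1)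
      = gaussianReal 0 (Real.toNNReal
          (∫ z, (∑ i, c i * z i) ^ 2 ∂(Measure.pi fun _ : ι => gaussianReal 0 1))) := by
  set ν := Measure.pi fun _ : ι => gaussianReal 0 1 with hν
  have hmap : ∀ i, ν.map (fun z : ι → ℝ => z i) = gaussianReal 0 1 := fun i =>
    (measurePreserving_eval (fun _ : ι => gaussianReal 0 1) i).map_eq
  have hind : iIndepFun (fun i (z : ι → ℝ) => c i * z i) ν :=
    iIndepFun_pi (X := fun i x => c i * x) (fun i => by fun_prop)
  have hlaw : ∀ i, HasLaw (fun z : ι → ℝ => c i * z i) (gaussianReal (c i * 0)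
      (⟨(c i) ^ 2, sq_nonneg _⟩ * 1)) ν := fun i =>
    gaussianReal_const_mul (X := fun z : ι → ℝ => z i) ⟨(measurable_pi_apply i).aemeasurable, hmap i⟩ (c i)
  have hg : ∀ i, HasGaussianLaw (fun z : ι → ℝ => c i * z i) ν := fun i =>
    (hlaw i).hasGaussianLaw
  have hsum : HasGaussianLaw (fun z : ι → ℝ => ∑ i, c i * z i) ν := hind.hasGaussianLaw_fun_sum hg
  have hmean : ∫ z, (∑ i, c i * z i) ∂ν = 0 := by
    rw [integral_finsetSum _ (fun i _ => (hg i).integrable)]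
    refine Finset.sum_eq_zero fun i _ => ?_
    rw [(hlaw i).integral_eq]
    simp
  rw [hsum.map_eq_gaussianReal, hmean, variance_of_integral_eq_zero
    (Continuous.measurable (by fun_prop)).aemeasurable hmean]

lemma aux_dslope (f : ℝ → ℝ) (hf : Differentiable ℝ f) (a : ℝ) : Continuous (dslope f a) := by
  rw [continuous_iff_continuousAt]
  intro b
  by_cases h : b = a
  · subst h
    exact continuousAt_dslope_same.2 (hf b)
  · exact (continuousAt_dslope_of_ne h).2 (hf b).continuousAt

/-- The difference quotient of the divergence in direction `z`, extended continuously to `t = 0`. -/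
noncomputable def auxH (φ : ℝ → ℝ) {M₀ : ℕ} (F G : Fin M₀ → ℝ)
    (x : ((Fin M₀ ⊕ Fin M₀) → ℝ) × ℝ) : ℝ :=
  ∑ i, (dslope φ (F i) (F i + x.2 * x.1 (Sum.inl i)) - deriv φ (G i + x.2 * x.1 (Sum.inr i)))
      * x.1 (Sum.inl i)
  + ∑ i, (-dslope φ (G i) (G i + x.2 * x.1 (Sum.inr i)) + deriv φ (G i + x.2 * x.1 (Sum.inr i))
      - (F i - G i) * dslope (deriv φ) (G i) (G i + x.2 * x.1 (Sum.inr i))) * x.1 (Sum.inr i)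

lemma auxH_continuous (φ : ℝ → ℝ) (h1 : Differentiable ℝ φ) (h2 : Differentiable ℝ (deriv φ))
    {M₀ : ℕ} (F G : Fin M₀ → ℝ) : Continuous (auxH φ F G) := by
  have a := aux_dslope φ h1
  have b := aux_dslope _ h2
  have c := h2.continuous
  unfold auxH
  refine Continuous.add (continuous_finsetSum _ fun i _ => ?_)
    (continuous_finsetSum _ fun i _ => ?_)
  · have := a (F i)
    fun_prop
  · have := a (G i)
    have := b (G i)
    fun_prop

lemma auxH_eq (φ : ℝ → ℝ) {M₀ : ℕ} (F G p q : Fin M₀ → ℝ) (s : ℝ) (hs : s ≠ 0) :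
    auxH φ F G (Sum.elim (fun i => s * (p i - F i)) (fun i => s * (q i - G i)), s⁻¹)
      = s * (bregmanVec φ p q - bregmanVec φ F G) := by
  unfold auxH bregmanVec
  rw [← Finset.sum_sub_distrib, Finset.mul_sum, ← Finset.sum_add_distrib]
  refine Finset.sum_congr rfl fun i _ => ?_
  have e1 : F i + s⁻¹ * (s * (p i - F i)) = p i := by field_simp; ring
  have e2 : G i + s⁻¹ * (s * (q i - G i)) = q i := by field_simp; ring
  simp only [Sum.elim_inl, Sum.elim_inr, e1, e2]
  have d1 := sub_smul_dslope φ (F i) (p i)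
  have d2 := sub_smul_dslope φ (G i) (q i)
  have d3 := sub_smul_dslope (deriv φ) (G i) (q i)
  simp only [smul_eq_mul] at d1 d2 d3
  linear_combination s * d1 - s * d2 - s * (F i - G i) * d3

/-- Theorem 5: asymptotic normality of the Bregman divergence
estimator under misspecification: if `√n((P̂ₙ − F), (Q̂ₙ − G))` converges in
distribution to a centered Gaussian law `μ` on `ℝ^{2M₀}`, then
`√n(D(P̂ₙ,Q̂ₙ) − D(F,G))` converges in distribution to the pushforward of `μ`
under `(x,y) ↦ Kᵀx + Nᵀy`, which is the centered normal law with variance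
`Λ_φ² = ∫ (Kᵀx + Nᵀy)² dμ`. -/
theorem bregman_asymptotic_normality
    {Ω : Type*} [MeasurableSpace Ω] (P : Measure Ω) [IsProbabilityMeasure P]
    (M₀ : ℕ) (hM₀ : 1 ≤ M₀)
    (φ : ℝ → ℝ) (hφC2 : ContDiff ℝ 2 φ) (hφconv : StrictConvexOn ℝ Set.univ φ)
    (F G : Fin M₀ → ℝ)
    -- the sequences of random vectors
    (Phat Qhat : ℕ → Ω → (Fin M₀ → ℝ))
    (hPmeas : ∀ n, Measurable (Phat n)) (hQmeas : ∀ n, Measurable (Qhat n))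
    -- μ is a centered Gaussian law on ℝ^{2M₀}
    (μ : Measure ((Fin M₀ ⊕ Fin M₀) → ℝ)) [IsProbabilityMeasure μ]
    (hμgauss : ∃ A : Matrix (Fin M₀ ⊕ Fin M₀) (Fin M₀ ⊕ Fin M₀) ℝ,
      μ = Measure.map (fun z => A.mulVec z)
        (Measure.pi fun _ : Fin M₀ ⊕ Fin M₀ => gaussianReal 0 1))
    -- √n((P̂ₙ − F),(Q̂ₙ − G)) converges in distribution to μ
    (hconv : ∀ g : BoundedContinuousFunction ((Fin M₀ ⊕ Fin M₀) → ℝ) ℝ,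
      Tendsto
        (fun n : ℕ => ∫ ω,
          g (Sum.elim (fun i => Real.sqrt n * (Phat n ω i - F i))
              (fun i => Real.sqrt n * (Qhat n ω i - G i))) ∂P)
        atTop (𝓝 (∫ z, g z ∂μ)))
    -- the gradient vectors K and N of D at (F,G)
    (K N : Fin M₀ → ℝ)
    (hK : ∀ i, K i = deriv φ (F i) - deriv φ (G i))
    (hN : ∀ i, N i = -(F i - G i) * deriv (deriv φ) (G i)) :
    -- conclusion: √n(D(P̂ₙ,Q̂ₙ) − D(F,G)) →d pushforward of μ under (x,y) ↦ Kᵀx + Nᵀy,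
    (∀ g : BoundedContinuousFunction ℝ ℝ,
      Tendsto
        (fun n : ℕ => ∫ ω,
          g (Real.sqrt n * (bregmanVec φ (Phat n ω) (Qhat n ω) - bregmanVec φ F G)) ∂P)
        atTop
        (𝓝 (∫ z, g (∑ i, K i * z (Sum.inl i) + ∑ i, N i * z (Sum.inr i)) ∂μ)))
    -- which is the centered normal law with variance Λ_φ² = ∫ (Kᵀx + Nᵀy)² dμ
    ∧ Measure.map
        (fun z : (Fin M₀ ⊕ Fin M₀) → ℝ =>
          ∑ i, K i * z (Sum.inl i) + ∑ i, N i * z (Sum.inr i)) μ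
      = gaussianReal 0
          (Real.toNNReal
            (∫ z, (∑ i, K i * z (Sum.inl i) + ∑ i, N i * z (Sum.inr i)) ^ 2 ∂μ)) := by
  constructor
  · have h1 : Differentiable ℝ φ := hφC2.differentiable (by norm_num)
    have h2 : Differentiable ℝ (deriv φ) :=
      (contDiff_succ_iff_deriv (n := 1).1 hφC2).2.2.differentiable (by norm_num)
    have hH := auxH_continuous φ h1 h2 F G
    let X : ℕ → Ω → ((Fin M₀ ⊕ Fin M₀) → ℝ) := fun n ω =>
      Sum.elim (fun i => Real.sqrt n * (Phat n ω i - F i))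
              (fun i => Real.sqrt n * (Qhat n ω i - G i))
    have hXm : ∀ n, Measurable (X n) := by
      intro n
      refine measurable_pi_iff.2 fun j => ?_
      have := hPmeas n
      have := hQmeas n
      rcases j with i | i
      · simp only [X, Sum.elim_inl]; fun_prop
      · simp only [X, Sum.elim_inr]; fun_prop
    have hX : TendstoInDistribution X atTop id (fun _ => P) μ := by
      refine ⟨fun n => (hXm n).aemeasurable, aemeasurable_id, ?_⟩
      refine ProbabilityMeasure.tendsto_iff_forall_integral_tendsto.2 ?_
      intro f
      have := hconv f
      simp only [ProbabilityMeasure.coe_mk, Measure.map_id]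
      refine this.congr fun n => ?_
      rw [integral_map (hXm n).aemeasurable f.continuous.aestronglyMeasurable]
    have hY : TendstoInMeasure P (fun (n : ℕ) (_ : Ω) => (Real.sqrt n)⁻¹) atTop
        (fun _ => (0 : ℝ)) := by
      refine tendstoInMeasure_of_tendsto_ae (fun n => aestronglyMeasurable_const) ?_
      refine Eventually.of_forall fun _ => ?_
      exact (Real.tendsto_sqrt_atTop.comp tendsto_natCast_atTop_atTop).inv_tendsto_atTop
    have hT := hX.continuous_comp_prodMk_of_tendstoInMeasure_const hH hY
      (fun _ => aemeasurable_const)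
    intro g
    have hT2 := (ProbabilityMeasure.tendsto_iff_forall_integral_tendsto.1 hT.tendsto) g
    simp only [ProbabilityMeasure.coe_mk] at hT2
    rw [integral_map hT.aemeasurable_limit g.continuous.aestronglyMeasurable] at hT2
    have hlim : ∀ z : (Fin M₀ ⊕ Fin M₀) → ℝ, auxH φ F G (id z, 0) =
        ∑ i, K i * z (Sum.inl i) + ∑ i, N i * z (Sum.inr i) := by
      intro z
      simp [auxH, hK, hN]
      rw [← Finset.sum_neg_distrib]
      exact Finset.sum_congr rfl fun i _ => by ring
    simp only [hlim] at hT2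
    refine hT2.congr' ?_
    filter_upwards [eventually_ge_atTop 1] with n hn
    rw [integral_map (hT.forall_aemeasurable n) g.continuous.aestronglyMeasurable]
    have hs : Real.sqrt n ≠ 0 := by
      have : (0 : ℝ) < n := by exact_mod_cast hn
      positivity
    simp only [X, auxH_eq φ F G _ _ _ hs]
  · obtain ⟨A, hA⟩ := hμgauss
    have hAm : Measurable (fun z : (Fin M₀ ⊕ Fin M₀) → ℝ => A.mulVec z) :=
      (Continuous.matrix_mulVec continuous_const continuous_id).measurable
    have key : ∀ z : (Fin M₀ ⊕ Fin M₀) → ℝ,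
        ∑ i, K i * (A.mulVec z) (Sum.inl i) + ∑ i, N i * (A.mulVec z) (Sum.inr i)
          = ∑ j, (Matrix.vecMul (Sum.elim K N) A) j * z j := by
      intro z
      have := Matrix.dotProduct_mulVec (Sum.elim K N) A z
      simp only [dotProduct, Fintype.sum_sum_type (f := fun j => Sum.elim K N j * _),
        Sum.elim_inl, Sum.elim_inr] at this
      exact this
    rw [hA, Measure.map_map (by fun_prop) hAm,
      integral_map hAm.aemeasurable (Continuous.aestronglyMeasurable (by fun_prop))]
    simp only [Function.comp_def, key]
    exact aux_gauss _
end

section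
/- (Theorem 7: asymptotic standard normality of the model selection statistic U.) Let F, G_θ, G_γ ∈ ℝ^{M₀} satisfy the null hypothesis D(F, G_θ) = D(F, G_γ). Let (P̂_n), (Q̂_n), (R̂_n) be sequences of random vectors in ℝ^{M₀} such that √n·((P̂_n − F), (Q̂_n − G_θ), (R̂_n − G_γ)) converges in distribution to a centered Gaussian law μ on ℝ^{3M₀}. Set T_θ := (φ'(F_i) − φ'(G_{θ,i}))_i, T_γ := (φ'(F_i) − φ'(G_{γ,i}))_i, V_θ := (−(F_i − G_{θ,i}) φ''(G_{θ,i}))_i, V_γ := (−(F_i − G_{γ,i}) φ''(G_{γ,i}))_i, and let κ² := ∫ ((T_θ − T_γ)ᵀx + V_θᵀy − V_γᵀz)² dμ(x,y,z). Assume κ > 0, and let (κ̂_n) be a sequence of random variables converging to κ in probability. Then the statistic U_n := (√n / κ̂_n)·(D(P̂_n, Q̂_n) − D(P̂_n, R̂_n)) converges in distribution to the standard normal law gaussianReal 0 1. -/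
open MeasureTheory ProbabilityTheory Filter Topology

/-- A finite product of standard Gaussians is Gaussian. -/
lemma bms_isGaussian_pi {ι : Type*} [Fintype ι] :
    IsGaussian (Measure.pi fun _ : ι => gaussianReal 0 1) := by
  have h1 : iIndepFun (fun (i : ι) (z : ι → ℝ) => z i)
      (Measure.pi fun _ : ι => gaussianReal 0 1) :=
    iIndepFun_pi (μ := fun _ : ι => gaussianReal 0 1) (𝓧 := fun _ : ι => ℝ)
      (X := fun _ (x : ℝ) => x) (fun _ => aemeasurable_id)
  have h2 : ∀ i : ι, HasGaussianLaw (fun z : ι → ℝ => z i)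
      (Measure.pi fun _ : ι => gaussianReal 0 1) := by
    intro i
    refine ⟨?_⟩
    have := (measurePreserving_eval (fun _ : ι => gaussianReal 0 1) i).map_eq
    change IsGaussian (Measure.map (Function.eval i) (Measure.pi fun _ : ι => gaussianReal 0 1))
    rw [this]; infer_instance
  have h3 := (iIndepFun.hasGaussianLaw (E := fun _ : ι => ℝ) h2 h1).isGaussian_map
  simpa using h3

lemma bms_integral_pi {ι : Type*} [Fintype ι] (L : (ι → ℝ) →L[ℝ] ℝ) :
    ∫ z, L z ∂(Measure.pi fun _ : ι => gaussianReal 0 1) = 0 := by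
  classical
  have := bms_isGaussian_pi (ι := ι)
  have hL : ∀ z : ι → ℝ, L z = ∑ i, L (Pi.single i 1) * z i := by
    intro z
    conv_lhs => rw [pi_eq_sum_univ' z]
    simp [map_sum, mul_comm, Pi.single]
  refine (integral_congr_ae (ae_of_all _ hL)).trans ?_
  rw [integral_finsetSum]
  · refine Finset.sum_eq_zero fun i _ => ?_
    rw [integral_const_mul]
    have h := (measurePreserving_eval (fun _ : ι => gaussianReal 0 1) i).map_eq
    have h2 : ∫ z : ι → ℝ, z i ∂(Measure.pi fun _ : ι => gaussianReal 0 1)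
        = ∫ x, x ∂(gaussianReal 0 1) := by
      have h4 : ∫ x, x ∂(Measure.map (Function.eval i) (Measure.pi fun _ : ι => gaussianReal 0 1))
          = ∫ z : ι → ℝ, z i ∂(Measure.pi fun _ : ι => gaussianReal 0 1) :=
        integral_map (measurable_pi_apply i).aemeasurable aestronglyMeasurable_id
      rw [← h4, h]
    rw [h2]; simp
  · intro i _
    exact (IsGaussian.integrable_dual _ 
      (ContinuousLinearMap.proj (R := ℝ) (φ := fun _ : ι => ℝ) i)).const_mul _

/-- Law of a normalised linear functional of a centered Gaussian vector. -/
lemma bms_law {ι : Type*} [Fintype ι] (μ : Measure (ι → ℝ)) [IsProbabilityMeasure μ]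
    (A : Matrix ι ι ℝ)
    (hμ : μ = Measure.map (fun z => A.mulVec z) (Measure.pi fun _ : ι => gaussianReal 0 1))
    (L : (ι → ℝ) →L[ℝ] ℝ) (κ : ℝ) (hκ : κ = Real.sqrt (∫ z, (L z) ^ 2 ∂μ)) (hpos : 0 < κ) :
    Measure.map (fun z => κ⁻¹ * L z) μ = gaussianReal 0 1 := by
  have := bms_isGaussian_pi (ι := ι)
  let B : (ι → ℝ) →L[ℝ] (ι → ℝ) := LinearMap.toContinuousLinearMap A.mulVecLin
  have hB : μ = Measure.map B (Measure.pi fun _ : ι => gaussianReal 0 1) := hμ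
  have hG : IsGaussian μ := by rw [hB]; infer_instance
  let L' : (ι → ℝ) →L[ℝ] ℝ := κ⁻¹ • L
  have hm : ∀ K : (ι → ℝ) →L[ℝ] ℝ, ∫ z, K z ∂μ = 0 := by
    intro K
    rw [hB, integral_map (by fun_prop) (by fun_prop)]
    exact bms_integral_pi (K.comp B)
  have h := hG.map_eq_gaussianReal L'
  have hsq : ∫ z, (L z) ^ 2 ∂μ = κ ^ 2 := by
    rw [hκ, Real.sq_sqrt (integral_nonneg fun z => sq_nonneg _)]
  have hv : Var[(L' : (ι → ℝ) → ℝ); μ] = 1 := by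
    rw [variance_of_integral_eq_zero (by fun_prop) (hm L')]
    have : ∀ z, (L' z) ^ 2 = (κ⁻¹) ^ 2 * (L z) ^ 2 := fun z => by
      simp [L', mul_pow]
    simp_rw [this]
    rw [integral_const_mul, hsq]; field_simp
  rw [hm L', hv] at h
  have hf : (L' : (ι → ℝ) → ℝ) = fun z => κ⁻¹ * L z := by
    ext z; simp [L']
  rw [hf] at h
  simpa using h

/-- Continuous mapping for convergence in probability to a constant. -/
lemma bms_inMeasure_comp {Ω E E' : Type*} [MeasurableSpace Ω] {P : Measure Ω}
    [PseudoMetricSpace E] [PseudoMetricSpace E'] {Y : ℕ → Ω → E} {c : E} {f : E → E'}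
    (hY : TendstoInMeasure P Y atTop (fun _ => c)) (hf : ContinuousAt f c) :
    TendstoInMeasure P (fun n ω => f (Y n ω)) atTop (fun _ => f c) := by
  rw [tendstoInMeasure_iff_dist] at hY ⊢
  intro ε hε
  obtain ⟨δ, hδ, h⟩ := Metric.continuousAt_iff.1 hf ε hε
  refine tendsto_of_tendsto_of_tendsto_of_le_of_le tendsto_const_nhds (hY δ hδ)
    (fun _ => zero_le) (fun n => measure_mono fun ω hω => ?_)
  simp only [Set.mem_ofPred_eq] at hω ⊢
  by_contra hlt
  exact absurd (h (not_le.1 hlt)) (not_lt.2 hω)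

/-- Convergence in distribution to `0` implies convergence in probability. -/
lemma bms_inMeasure_zero {Ω E : Type*} [MeasurableSpace Ω] {P : Measure Ω}
    [IsProbabilityMeasure P] [NormedAddCommGroup E] [MeasurableSpace E] [BorelSpace E]
    {Y : ℕ → Ω → E} (hYm : ∀ n, Measurable (Y n))
    (h : ∀ g : BoundedContinuousFunction E ℝ,
      Tendsto (fun n => ∫ ω, g (Y n ω) ∂P) atTop (𝓝 (g 0))) :
    TendstoInMeasure P Y atTop (fun _ => 0) := by
  rw [tendstoInMeasure_iff_measureReal_norm]
  intro ε hε
  let g : BoundedContinuousFunction E ℝ := BoundedContinuousFunction.ofNormedAddCommGroup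
    (fun x => min ε ‖x‖) (by fun_prop) ε (fun x => by
      rw [Real.norm_of_nonneg (by positivity)]; exact min_le_left _ _)
  have hg : ∀ x, g x = min ε ‖x‖ := fun x => rfl
  have h0 := (h g).const_mul ε⁻¹
  have hg0 : g 0 = 0 := by simp [hg, hε.le]
  rw [hg0, mul_zero] at h0
  refine tendsto_of_tendsto_of_tendsto_of_le_of_le tendsto_const_nhds h0
    (fun _ => measureReal_nonneg) (fun n => ?_)
  have hi : Integrable (fun ω => g (Y n ω)) P := by
    refine Integrable.of_bound (C := ε)
      ((g.continuous.measurable.comp (hYm n)).aestronglyMeasurable) (Eventually.of_forall fun ω => ?_)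
    rw [hg, Real.norm_of_nonneg (by positivity)]; exact min_le_left _ _
  have hM := mul_meas_ge_le_integral_of_nonneg (μ := P) (f := fun ω => g (Y n ω))
    (Eventually.of_forall fun ω => by simp only [hg, Pi.zero_apply]; positivity) hi ε
  have hs : {x | ε ≤ ‖Y n x - 0‖} = {ω | ε ≤ g (Y n ω)} := by
    ext ω; simp [hg]
  rw [hs, inv_mul_eq_div, le_div_iff₀ hε, mul_comm]
  exact hM

/-- Convergence in distribution from test functions. -/
lemma bms_toDist {Ω Ω' E : Type*} [MeasurableSpace Ω] {P : Measure Ω} [IsProbabilityMeasure P]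
    [MeasurableSpace Ω'] {P' : Measure Ω'} [IsProbabilityMeasure P']
    [TopologicalSpace E] [MeasurableSpace E] [OpensMeasurableSpace E]
    [TopologicalSpace.PseudoMetrizableSpace E] [SecondCountableTopology E]
    {X : ℕ → Ω → E} {Z : Ω' → E} (hX : ∀ n, Measurable (X n)) (hZ : Measurable Z) :
    TendstoInDistribution X atTop Z (fun _ => P) P' ↔
    ∀ g : BoundedContinuousFunction E ℝ,
      Tendsto (fun n => ∫ ω, g (X n ω) ∂P) atTop (𝓝 (∫ z, g (Z z) ∂P')) := by
  have key : ∀ g : BoundedContinuousFunction E ℝ,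
      (fun n => ∫ x, g x ∂(P.map (X n))) = (fun n => ∫ ω, g (X n ω) ∂P) ∧
      ∫ x, g x ∂(P'.map Z) = ∫ z, g (Z z) ∂P' := by
    intro g
    have hg : Measurable g := g.continuous.measurable
    refine ⟨funext fun n => integral_map (hX n).aemeasurable hg.aestronglyMeasurable,
      integral_map hZ.aemeasurable hg.aestronglyMeasurable⟩
  constructor
  · intro h g
    have := ProbabilityMeasure.tendsto_iff_forall_integral_tendsto.1 h.tendsto g
    simp only [ProbabilityMeasure.coe_mk] at this
    rwa [(key g).1, (key g).2] at this
  · intro h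
    refine ⟨fun n => (hX n).aemeasurable, hZ.aemeasurable, ?_⟩
    refine ProbabilityMeasure.tendsto_iff_forall_integral_tendsto.2 fun g => ?_
    simp only [ProbabilityMeasure.coe_mk]
    rw [(key g).1, (key g).2]
    exact h g

/-- Delta method combined with Slutsky. -/
lemma bms_delta {Ω E : Type*} [MeasurableSpace Ω] {P : Measure Ω} [IsProbabilityMeasure P]
    [NormedAddCommGroup E] [NormedSpace ℝ E] [MeasurableSpace E] [BorelSpace E]
    [SecondCountableTopology E] {μ : Measure E} [IsProbabilityMeasure μ]
    {X : ℕ → Ω → E} (hX : ∀ n, Measurable (X n))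
    (hconv : ∀ g : BoundedContinuousFunction E ℝ,
      Tendsto (fun n => ∫ ω, g (X n ω) ∂P) atTop (𝓝 (∫ z, g z ∂μ)))
    (h : E → ℝ) (hh : Measurable h) (w : E) (L : E →L[ℝ] ℝ) (hL : HasFDerivAt h L w)
    (hw : h w = 0) {κ : ℝ} (hκ : 0 < κ) {κhat : ℕ → Ω → ℝ} (hκm : ∀ n, Measurable (κhat n))
    (hκhat : TendstoInMeasure P κhat atTop (fun _ => κ)) (g : BoundedContinuousFunction ℝ ℝ) :
    Tendsto (fun n : ℕ => ∫ ω, g ((Real.sqrt n / κhat n ω) *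
        h (w + (Real.sqrt n)⁻¹ • X n ω)) ∂P) atTop (𝓝 (∫ z, g (κ⁻¹ * L z) ∂μ)) := by
  have hXd : TendstoInDistribution X atTop (id : E → E) (fun _ => P) μ :=
    (bms_toDist hX measurable_id).2 hconv
  have hs : Tendsto (fun n : ℕ => (Real.sqrt n)⁻¹) atTop (𝓝 0) :=
    tendsto_inv_atTop_zero.comp (Real.tendsto_sqrt_atTop.comp tendsto_natCast_atTop_atTop)
  have hsm : TendstoInMeasure P (fun (n : ℕ) (_ : Ω) => (Real.sqrt n)⁻¹) atTop (fun _ => (0 : ℝ)) :=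
    tendstoInMeasure_of_tendsto_ae (fun n => aestronglyMeasurable_const)
      (Eventually.of_forall fun _ => hs)
  have hY1 := hXd.continuous_comp_prodMk_of_tendstoInMeasure_const
    (g := fun p : E × ℝ => p.2 • p.1) (by fun_prop) hsm (fun n => aemeasurable_const)
  have hYm : ∀ n : ℕ, Measurable (fun ω => (Real.sqrt n)⁻¹ • X n ω) :=
    fun n => (hX n).const_smul _
  have hY : TendstoInMeasure P (fun (n : ℕ) ω => (Real.sqrt n)⁻¹ • X n ω) atTop
      (fun _ => (0 : E)) := by
    refine bms_inMeasure_zero hYm fun g => ?_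
    have := (bms_toDist hYm (by fun_prop)).1 hY1 g
    simpa using this
  let ρ : E → ℝ := fun v => ‖v‖⁻¹ * (h (w + v) - L v)
  have hρm : Measurable ρ := by
    have : Measurable (fun v : E => h (w + v)) := hh.comp (by fun_prop)
    fun_prop
  have hρ0 : ρ 0 = 0 := by simp [ρ]
  have hρ : ContinuousAt ρ 0 := by
    have h1 := hasFDerivAt_iff_tendsto.1 hL
    have h2 : Tendsto (fun v : E => w + v) (𝓝 0) (𝓝 w) := by
      have : Continuous (fun v : E => w + v) := by fun_prop
      simpa using this.tendsto 0
    have h3 := h1.comp h2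
    unfold ContinuousAt
    rw [hρ0]
    refine squeeze_zero_norm (fun v => le_of_eq ?_) h3
    simp [ρ, hw]
  have hρY := bms_inMeasure_comp hY hρ
  have hκi := bms_inMeasure_comp hκhat (continuousAt_inv₀ hκ.ne')
  rw [hρ0] at hρY
  have hS1 := hXd.continuous_comp_prodMk_of_tendstoInMeasure_const
    (g := fun p : E × ℝ => L p.1 + ‖p.1‖ * p.2) (by fun_prop) hρY
    (fun n => (hρm.comp (hYm n)).aemeasurable)
  have hS2 := hS1.continuous_comp_prodMk_of_tendstoInMeasure_const
    (g := fun p : ℝ × ℝ => p.2 * p.1) (by fun_prop) hκi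
    (fun n => (hκm n).inv.aemeasurable)
  have hmeas : ∀ n : ℕ, Measurable (fun ω => (κhat n ω)⁻¹ *
      (L (X n ω) + ‖X n ω‖ * ρ ((Real.sqrt n)⁻¹ • X n ω))) := by
    intro n
    have h1 := hρm.comp (hYm n)
    have h2 := hX n
    have h3 := hκm n
    have h4 : Measurable (fun ω => ρ ((Real.sqrt n)⁻¹ • X n ω)) := h1
    fun_prop
  have hfin := (bms_toDist hmeas (by fun_prop)).1 hS2 g
  simp only [id, mul_zero, add_zero] at hfin
  refine hfin.congr' ?_
  filter_upwards [eventually_gt_atTop 0] with n hn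
  congr 1
  ext ω
  congr 1
  have hpos : 0 < Real.sqrt n := Real.sqrt_pos.2 (by exact_mod_cast hn)
  by_cases hx : X n ω = 0
  · simp [hx, hw]
  · have hx' : ‖X n ω‖ ≠ 0 := norm_ne_zero_iff.2 hx
    simp only [ρ, norm_smul, norm_inv, Real.norm_of_nonneg hpos.le, map_smul, smul_eq_mul]
    field_simp
    ring

lemma bms_fderiv {M₀ : ℕ} (φ : ℝ → ℝ) (hφ : ContDiff ℝ 2 φ)
    (F Gθ Gγ Tθ Tγ Vθ Vγ : Fin M₀ → ℝ)
    (hTθ : ∀ i, Tθ i = deriv φ (F i) - deriv φ (Gθ i))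
    (hTγ : ∀ i, Tγ i = deriv φ (F i) - deriv φ (Gγ i))
    (hVθ : ∀ i, Vθ i = -(F i - Gθ i) * deriv (deriv φ) (Gθ i))
    (hVγ : ∀ i, Vγ i = -(F i - Gγ i) * deriv (deriv φ) (Gγ i)) :
    ∃ L : ((Fin M₀ ⊕ (Fin M₀ ⊕ Fin M₀)) → ℝ) →L[ℝ] ℝ,
      (∀ z, L z = ∑ i, (Tθ i - Tγ i) * z (Sum.inl i)
        + ∑ i, Vθ i * z (Sum.inr (Sum.inl i))
        - ∑ i, Vγ i * z (Sum.inr (Sum.inr i))) ∧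
      HasFDerivAt (fun w : (Fin M₀ ⊕ (Fin M₀ ⊕ Fin M₀)) → ℝ =>
        bregmanVec φ (fun i => w (Sum.inl i)) (fun i => w (Sum.inr (Sum.inl i)))
        - bregmanVec φ (fun i => w (Sum.inl i)) (fun i => w (Sum.inr (Sum.inr i)))) L
        (Sum.elim F (Sum.elim Gθ Gγ)) := by
  have hd1 : Differentiable ℝ φ := hφ.differentiable (by norm_num)
  have hd2 : Differentiable ℝ (deriv φ) :=
    (contDiff_succ_iff_deriv.1 (show ContDiff ℝ (1 + 1) φ from hφ)).2.2.differentiable (by norm_num)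
  let w0 : (Fin M₀ ⊕ (Fin M₀ ⊕ Fin M₀)) → ℝ := Sum.elim F (Sum.elim Gθ Gγ)
  have hpr : ∀ j, HasFDerivAt (fun w : (Fin M₀ ⊕ (Fin M₀ ⊕ Fin M₀)) → ℝ => w j)
      (ContinuousLinearMap.proj (R := ℝ) j) w0 := fun j => hasFDerivAt_apply j w0
  have hc1 : ∀ b, HasFDerivAt (fun w : (Fin M₀ ⊕ (Fin M₀ ⊕ Fin M₀)) → ℝ => φ (w b))
      (deriv φ (w0 b) • ContinuousLinearMap.proj (R := ℝ) b) w0 := fun b =>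
    (hd1 (w0 b)).hasDerivAt.comp_hasFDerivAt w0 (hpr b)
  have hc2 : ∀ b, HasFDerivAt (fun w : (Fin M₀ ⊕ (Fin M₀ ⊕ Fin M₀)) → ℝ => deriv φ (w b))
      (deriv (deriv φ) (w0 b) • ContinuousLinearMap.proj (R := ℝ) b) w0 := fun b =>
    HasDerivAt.comp_hasFDerivAt (h₂ := deriv φ) w0 (hd2 (w0 b)).hasDerivAt (hpr b)
  have hterm := fun a b =>
    ((hc1 a).fun_sub (hc1 b)).fun_sub (((hpr a).fun_sub (hpr b)).fun_mul (hc2 b))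
  have hD := (HasFDerivAt.fun_sum (u := Finset.univ)
      (fun (i : Fin M₀) _ => hterm (Sum.inl i) (Sum.inr (Sum.inl i)))).sub
    (HasFDerivAt.fun_sum (u := Finset.univ)
      (fun (i : Fin M₀) _ => hterm (Sum.inl i) (Sum.inr (Sum.inr i))))
  refine ⟨_, ?_, hD⟩
  intro z
  simp [w0, hTθ, hTγ, hVθ, hVγ]
  simp only [← Finset.sum_add_distrib, ← Finset.sum_sub_distrib]
  refine Finset.sum_congr rfl fun i _ => ?_
  ring

/-- Theorem 7: under the null hypothesis
`D(F,G_θ) = D(F,G_γ)`, the model selection statistic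
`Uₙ = (√n/κ̂ₙ)(D(P̂ₙ,Q̂ₙ) − D(P̂ₙ,R̂ₙ))` converges in distribution to the
standard normal law. -/
theorem bregman_model_selection_statistic
    {Ω : Type*} [MeasurableSpace Ω] (P : Measure Ω) [IsProbabilityMeasure P]
    (M₀ : ℕ) (hM₀ : 1 ≤ M₀)
    (φ : ℝ → ℝ) (hφC2 : ContDiff ℝ 2 φ) (hφconv : StrictConvexOn ℝ Set.univ φ)
    -- the null hypothesis: the two models are at equal Bregman distance from F
    (F Gθ Gγ : Fin M₀ → ℝ)
    (hnull : bregmanVec φ F Gθ = bregmanVec φ F Gγ)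
    -- the sequences of random vectors
    (Phat Qhat Rhat : ℕ → Ω → (Fin M₀ → ℝ))
    (hPmeas : ∀ n, Measurable (Phat n)) (hQmeas : ∀ n, Measurable (Qhat n))
    (hRmeas : ∀ n, Measurable (Rhat n))
    -- μ is a centered Gaussian law on ℝ^{3M₀}
    (μ : Measure ((Fin M₀ ⊕ (Fin M₀ ⊕ Fin M₀)) → ℝ)) [IsProbabilityMeasure μ]
    (hμgauss : ∃ A : Matrix (Fin M₀ ⊕ (Fin M₀ ⊕ Fin M₀)) (Fin M₀ ⊕ (Fin M₀ ⊕ Fin M₀)) ℝ,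
      μ = Measure.map (fun z => A.mulVec z)
        (Measure.pi fun _ : Fin M₀ ⊕ (Fin M₀ ⊕ Fin M₀) => gaussianReal 0 1))
    -- √n((P̂ₙ − F),(Q̂ₙ − G_θ),(R̂ₙ − G_γ)) converges in distribution to μ
    (hconv : ∀ g : BoundedContinuousFunction ((Fin M₀ ⊕ (Fin M₀ ⊕ Fin M₀)) → ℝ) ℝ,
      Tendsto
        (fun n : ℕ => ∫ ω,
          g (Sum.elim (fun i => Real.sqrt n * (Phat n ω i - F i))
              (Sum.elim (fun i => Real.sqrt n * (Qhat n ω i - Gθ i))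
                (fun i => Real.sqrt n * (Rhat n ω i - Gγ i)))) ∂P)
        atTop (𝓝 (∫ z, g z ∂μ)))
    -- the gradient vectors
    (Tθ Tγ Vθ Vγ : Fin M₀ → ℝ)
    (hTθ : ∀ i, Tθ i = deriv φ (F i) - deriv φ (Gθ i))
    (hTγ : ∀ i, Tγ i = deriv φ (F i) - deriv φ (Gγ i))
    (hVθ : ∀ i, Vθ i = -(F i - Gθ i) * deriv (deriv φ) (Gθ i))
    (hVγ : ∀ i, Vγ i = -(F i - Gγ i) * deriv (deriv φ) (Gγ i))
    -- κ² and κ > 0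
    (κ : ℝ)
    (hκdef : κ = Real.sqrt (∫ z,
      (∑ i, (Tθ i - Tγ i) * z (Sum.inl i)
        + ∑ i, Vθ i * z (Sum.inr (Sum.inl i))
        - ∑ i, Vγ i * z (Sum.inr (Sum.inr i))) ^ 2 ∂μ))
    (hκpos : 0 < κ)
    -- the estimators κ̂ₙ of κ, converging to κ in probability
    (κhat : ℕ → Ω → ℝ) (hκhatmeas : ∀ n, Measurable (κhat n))
    (hκhat : TendstoInMeasure P κhat atTop (fun _ => κ)) :
    -- conclusion: Uₙ converges in distribution to the standard normal law
    ∀ g : BoundedContinuousFunction ℝ ℝ,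
      Tendsto
        (fun n : ℕ => ∫ ω,
          g ((Real.sqrt n / κhat n ω) *
            (bregmanVec φ (Phat n ω) (Qhat n ω)
              - bregmanVec φ (Phat n ω) (Rhat n ω))) ∂P)
        atTop (𝓝 (∫ x, g x ∂(gaussianReal 0 1))) := by
  obtain ⟨A, hA⟩ := hμgauss
  obtain ⟨L, hLz, hL⟩ := bms_fderiv φ hφC2 F Gθ Gγ Tθ Tγ Vθ Vγ hTθ hTγ hVθ hVγ
  have hd1 : Continuous φ := hφC2.continuous
  have hd2 : Continuous (deriv φ) := hφC2.continuous_deriv (by norm_num)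
  intro g
  have hlaw := bms_law μ A hA L κ (by simpa only [hLz] using hκdef) hκpos
  have hX : ∀ n : ℕ, Measurable (fun ω =>
      (Sum.elim (fun i => Real.sqrt n * (Phat n ω i - F i))
        (Sum.elim (fun i => Real.sqrt n * (Qhat n ω i - Gθ i))
          (fun i => Real.sqrt n * (Rhat n ω i - Gγ i))) :
            (Fin M₀ ⊕ (Fin M₀ ⊕ Fin M₀)) → ℝ)) := by
    intro n
    have h1 := hPmeas n
    have h2 := hQmeas n
    have h3 := hRmeas n
    refine measurable_pi_lambda _ ?_
    rintro (i | i | i) <;> simp only [Sum.elim_inl, Sum.elim_inr] <;> fun_prop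
  have hmain := bms_delta (P := P) (μ := μ) hX hconv _ (by
      have : Continuous (fun w : (Fin M₀ ⊕ (Fin M₀ ⊕ Fin M₀)) → ℝ =>
        bregmanVec φ (fun i => w (Sum.inl i)) (fun i => w (Sum.inr (Sum.inl i)))
        - bregmanVec φ (fun i => w (Sum.inl i)) (fun i => w (Sum.inr (Sum.inr i)))) := by
        unfold bregmanVec
        fun_prop
      exact this.measurable) _ L hL (by simp [hnull]) hκpos hκhatmeas hκhat g
  have hlim : ∫ z, g (κ⁻¹ * L z) ∂μ = ∫ x, g x ∂(gaussianReal 0 1) := by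
    rw [← hlaw, integral_map (by fun_prop) g.continuous.measurable.aestronglyMeasurable]
  rw [hlim] at hmain
  refine hmain.congr' ?_
  filter_upwards [eventually_gt_atTop 0] with n hn
  have hpos : Real.sqrt n ≠ 0 := (Real.sqrt_pos.2 (by exact_mod_cast hn)).ne'
  simp [inv_mul_cancel_left₀ hpos]
end
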